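/- Consider the (VS-SQN) scheme under the stated assumptions with stepsize γ_k = 1/(L·λ̄) for all k and geometrically increasing batch sizes N_k = ⌈N_0 ρ^{−k}⌉ where ρ ∈ (0,1) and N_0 > 2ν₁²λ̄/(τ²λ̲), so that a := 1 − τλ̲/(Lλ̄) + 2ν₁²/(L τ N_0) ∈ (0,1); assume moreover a ≠ ρ. Define C := E[f(x_0) − f(x*)] + ((2ν₁²‖x*‖² + ν₂²)/(2 N_0 L)) · 1/(1 − min{a,ρ}/max{a,ρ}). Then for every K ≥ 0, E[f(x_{K+1}) − f(x*)] ≤ C·(max{a,ρ})^K; i.e., the scheme converges linearly in expectation. -/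

import Mathlib

open MeasureTheory Filter
open scoped RealInnerProductSpace Topology

noncomputable section

section InnerProductSpace

variable {E : Type*} [NormedAddCommGroup E] [InnerProductSpace ℝ E]

section Gradient

variable [CompleteSpace E] {f : E → ℝ} {gf : E → E}

theorem HasGradientAt.hasDerivAt_comp_add_smul {g x d : E} {t : ℝ}
    (h : HasGradientAt f g (x + t • d)) :
    HasDerivAt (fun s : ℝ => f (x + s • d)) ⟪g, d⟫ t := by
  have hl : HasDerivAt (fun s : ℝ => x + s • d) d t := by
    simpa using ((hasDerivAt_id t).smul_const d).const_add x
  have hc := h.hasFDerivAt.comp_hasDerivAt t hl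
  rwa [InnerProductSpace.toDual_apply_apply] at hc

/-- The descent lemma for a function with Lipschitz gradient. -/
theorem le_add_inner_add_of_lipschitz_gradient {L : ℝ}
    (hgrad : ∀ z, HasGradientAt f (gf z) z)
    (hlip : ∀ z z', ‖gf z - gf z'‖ ≤ L * ‖z - z'‖) (x d : E) :
    f (x + d) ≤ f x + ⟪gf x, d⟫ + L / 2 * ‖d‖ ^ 2 := by
  set φ : ℝ → ℝ := fun t => f (x + t • d) - (t * ⟪gf x, d⟫ + L / 2 * ‖d‖ ^ 2 * t ^ 2)
  have hφ : ∀ t, HasDerivAt φ (⟪gf (x + t • d), d⟫ - (⟪gf x, d⟫ + L * ‖d‖ ^ 2 * t)) t := by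
    intro t
    have h := ((hgrad (x + t • d)).hasDerivAt_comp_add_smul).sub
      (((hasDerivAt_id t).mul_const ⟪gf x, d⟫).add
        (((hasDerivAt_id t).pow 2).const_mul (L / 2 * ‖d‖ ^ 2)))
    refine HasDerivAt.congr_deriv (f := φ) h ?_
    simp only [id_eq]
    norm_num
    ring
  have hanti : AntitoneOn φ (Set.Icc 0 1) := by
    refine antitoneOn_of_deriv_nonpos (convex_Icc 0 1)
      (fun t _ => (hφ t).continuousAt.continuousWithinAt)
      (fun t _ => (hφ t).differentiableAt.differentiableWithinAt) fun t ht => ?_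
    rw [interior_Icc] at ht
    rw [(hφ t).deriv]
    have h1 : ‖gf (x + t • d) - gf x‖ ≤ L * (t * ‖d‖) := by
      simpa [norm_smul, abs_of_pos ht.1] using hlip (x + t • d) x
    have h2 := real_inner_le_norm (gf (x + t • d) - gf x) d
    rw [inner_sub_left] at h2
    nlinarith [mul_le_mul_of_nonneg_right h1 (norm_nonneg d)]
  have h := hanti (Set.left_mem_Icc.2 zero_le_one) (Set.right_mem_Icc.2 zero_le_one) zero_le_one
  simp [φ] at h
  linarith

/-- The first-order characterization of strong convexity. -/
theorem StrongConvexOn.add_inner_add_le {τ : ℝ} (hsc : StrongConvexOn Set.univ τ f) {g x : E}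
    (hgrad : HasGradientAt f g x) (y : E) :
    f x + ⟪g, y - x⟫ + τ / 2 * ‖y - x‖ ^ 2 ≤ f y := by
  have hd : HasDerivAt (fun s : ℝ => f (x + s • (y - x))) ⟪g, y - x⟫ 0 :=
    HasGradientAt.hasDerivAt_comp_add_smul (by simpa using hgrad)
  have hlim := hd.tendsto_slope_zero_right
  have hlim' : Tendsto (fun t : ℝ => f y - f x - (1 - t) * (τ / 2 * ‖y - x‖ ^ 2)) (𝓝[>] 0)
      (𝓝 (f y - f x - (1 - 0) * (τ / 2 * ‖y - x‖ ^ 2))) :=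
    ((by fun_prop : Continuous fun t : ℝ =>
      f y - f x - (1 - t) * (τ / 2 * ‖y - x‖ ^ 2)).tendsto 0).mono_left nhdsWithin_le_nhds
  have hle : ⟪g, y - x⟫ ≤ f y - f x - (1 - 0) * (τ / 2 * ‖y - x‖ ^ 2) := by
    refine le_of_tendsto_of_tendsto hlim hlim' ?_
    filter_upwards [Ioo_mem_nhdsGT (zero_lt_one' ℝ)] with t ht
    have h := hsc.2 (Set.mem_univ x) (Set.mem_univ y) (sub_nonneg.2 ht.2.le) ht.1.le
      (sub_add_cancel 1 t)
    have hpt : (1 - t) • x + t • y = x + t • (y - x) := by module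
    rw [hpt, norm_sub_rev x y] at h
    simp only [smul_eq_mul, zero_add, zero_smul, add_zero] at h ⊢
    rw [inv_mul_le_iff₀ ht.1]
    linarith
  linarith

/-- The Polyak–Łojasiewicz inequality for strongly convex functions. -/
theorem StrongConvexOn.two_mul_sub_le_norm_sq {τ : ℝ} (hτ : 0 < τ)
    (hsc : StrongConvexOn Set.univ τ f) {g x : E} (hgrad : HasGradientAt f g x) (y : E) :
    2 * τ * (f x - f y) ≤ ‖g‖ ^ 2 := by
  have h := hsc.add_inner_add_le hgrad y
  have hsq : 0 ≤ ‖g + τ • (y - x)‖ ^ 2 := sq_nonneg _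
  rw [norm_add_sq_real, norm_smul, inner_smul_right, mul_pow, Real.norm_eq_abs, sq_abs] at hsq
  nlinarith

/-- Quadratic growth of a strongly convex function around its minimizer. -/
theorem StrongConvexOn.norm_sub_sq_le {τ : ℝ} (hsc : StrongConvexOn Set.univ τ f)
    {g x₀ : E} (hgrad : HasGradientAt f g x₀) (hmin : ∀ z, f x₀ ≤ f z) (x : E) :
    τ / 2 * ‖x - x₀‖ ^ 2 ≤ f x - f x₀ := by
  have hg : g = 0 := by
    have h := (show IsLocalMin f x₀ from Eventually.of_forall hmin).hasFDerivAt_eq_zero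
      hgrad.hasFDerivAt
    simpa using h
  have h := hsc.add_inner_add_le hgrad x
  rw [hg, inner_zero_left] at h
  linarith

end Gradient

namespace LinearMap.IsSymmetric

variable {T : E →ₗ[ℝ] E} {M : ℝ}

theorem norm_sq_le_mul_inner (hT : T.IsSymmetric) (hM : 0 < M)
    (h0 : ∀ v, 0 ≤ ⟪T v, v⟫) (hub : ∀ v, ⟪T v, v⟫ ≤ M * ‖v‖ ^ 2) (v : E) :
    ‖T v‖ ^ 2 ≤ M * ⟪T v, v⟫ := by
  have h1 := h0 (M • v - T v)
  have h2 := hub (T v)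
  simp only [map_sub, map_smul, inner_sub_left, inner_sub_right, inner_smul_left,
    inner_smul_right, hT (T v) v, real_inner_self_eq_norm_sq, RCLike.conj_to_real] at h1
  nlinarith

end LinearMap.IsSymmetric

/-- One step of a preconditioned gradient method with perturbed gradient and
stepsize `1 / (L * M)`. -/
theorem sub_preconditioned_step_le [CompleteSpace E] {f : E → ℝ} {gf : E → E} {L m M : ℝ}
    (hL : 0 < L) (hm : 0 ≤ m) (hM : 0 < M)
    (hgrad : ∀ z, HasGradientAt f (gf z) z)
    (hlip : ∀ z z', ‖gf z - gf z'‖ ≤ L * ‖z - z'‖)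
    {T : E →ₗ[ℝ] E} (hT : T.IsSymmetric)
    (hb : ∀ v, m * ‖v‖ ^ 2 ≤ ⟪T v, v⟫ ∧ ⟪T v, v⟫ ≤ M * ‖v‖ ^ 2) (x w : E) :
    f (x - (1 / (L * M)) • T (gf x + w))
      ≤ f x - m / (2 * L * M) * ‖gf x‖ ^ 2 + 1 / (2 * L) * ‖w‖ ^ 2 := by
  have h0 : ∀ v, 0 ≤ ⟪T v, v⟫ := fun v => (by positivity : 0 ≤ m * ‖v‖ ^ 2).trans (hb v).1
  have hdesc := le_add_inner_add_of_lipschitz_gradient hgrad hlip x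
    (-((1 / (L * M)) • T (gf x + w)))
  have hn := hT.norm_sq_le_mul_inner hM h0 (fun v => (hb v).2) (gf x + w)
  rw [← sub_eq_add_neg, norm_neg, norm_smul, mul_pow, inner_neg_right, inner_smul_right,
    Real.norm_eq_abs, sq_abs] at hdesc
  have hsplit : ⟪T (gf x + w), gf x + w⟫
      = ⟪T (gf x), gf x⟫ + 2 * ⟪gf x, T w⟫ + ⟪T w, w⟫ := by
    rw [map_add, inner_add_left, inner_add_right, inner_add_right, hT (gf x) w,
      real_inner_comm (gf x) (T w)]
    ring
  have hcross : ⟪gf x, T (gf x + w)⟫ = ⟪T (gf x), gf x⟫ + ⟪gf x, T w⟫ := by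
    rw [map_add, inner_add_right, hT (gf x) (gf x)]
  have hg := (hb (gf x)).1
  have hw := (hb w).2
  rw [hsplit] at hn
  rw [hcross] at hdesc
  calc _ ≤ _ := hdesc
    _ ≤ f x + -(1 / (L * M) * (⟪T (gf x), gf x⟫ + ⟪gf x, T w⟫)) + L / 2 * ((1 / (L * M)) ^ 2 *
        (M * (⟪T (gf x), gf x⟫ + 2 * ⟪gf x, T w⟫ + ⟪T w, w⟫))) := by gcongr
    _ = f x - 1 / (2 * L * M) * ⟪T (gf x), gf x⟫ + 1 / (2 * L * M) * ⟪T w, w⟫ := by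
      field_simp
      ring
    _ ≤ f x - 1 / (2 * L * M) * (m * ‖gf x‖ ^ 2) + 1 / (2 * L * M) * (M * ‖w‖ ^ 2) := by
      gcongr
    _ = _ := by
      field_simp

end InnerProductSpace

/-- If `y = A v` with `A` measurable and almost surely invertible, then `v` inherits
measurability from `A` and `y`. -/
theorem aestronglyMeasurable_of_toEuclideanLin {n : ℕ} {Ω : Type*} {m0 : MeasurableSpace Ω}
    {P : Measure Ω} {A : Ω → Matrix (Fin n) (Fin n) ℝ} {v y : Ω → EuclideanSpace ℝ (Fin n)}
    (hA : ∀ i j, Measurable fun ω => A ω i j) (hdet : ∀ᵐ ω ∂P, (A ω).det ≠ 0)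
    (hy : Measurable y) (h : ∀ ω, (Matrix.toEuclideanLin (A ω)) (v ω) = y ω) :
    AEStronglyMeasurable v P := by
  have hAm : Measurable fun ω => (fun i j => A ω i j : Fin n → Fin n → ℝ) :=
    measurable_pi_iff.2 fun i => measurable_pi_iff.2 fun j => hA i j
  have hof : Continuous fun B : Fin n → Fin n → ℝ => Matrix.of B := continuous_id
  have hdetm : Measurable fun ω => (A ω).det :=
    hof.matrix_det.measurable.comp hAm
  have hadj : Measurable fun ω => WithLp.toLp 2 ((A ω).adjugate.mulVec (y ω).ofLp) := by
    refine (WithLp.measurable_toLp 2 _).comp (measurable_pi_iff.2 fun i => ?_)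
    have hij : ∀ j, Measurable fun ω => (A ω).adjugate i j := fun j =>
      (hof.matrix_adjugate.matrix_elem i j).measurable.comp hAm
    have hyj : ∀ j, Measurable fun ω => y ω j := fun j =>
      (EuclideanSpace.proj (𝕜 := ℝ) j).continuous.measurable.comp hy
    have hsum : Measurable fun ω => ∑ j, (A ω).adjugate i j * y ω j :=
      Finset.measurable_fun_sum _ fun j _ => (hij j).mul (hyj j)
    exact hsum
  refine ⟨_, (hdetm.inv.smul hadj).stronglyMeasurable, ?_⟩
  filter_upwards [hdet] with ω hω
  simp only [Pi.smul_apply', Pi.inv_apply]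
  rw [← h ω, eq_inv_smul_iff₀ hω, Matrix.ofLp_toLpLin, Matrix.toLin'_apply, Matrix.mulVec_mulVec,
    Matrix.adjugate_mul, Matrix.smul_mulVec, Matrix.one_mulVec]
  rfl

theorem geometric_recursion_le {F : ℕ → ℝ} {a ρ B : ℝ} (ha : 0 ≤ a) (hane : a ≠ ρ)
    (hF : ∀ k, F (k + 1) ≤ a * F k + B * ρ ^ k) (k : ℕ) :
    F k ≤ a ^ k * F 0 + B * ((a ^ k - ρ ^ k) / (a - ρ)) := by
  have hne : a - ρ ≠ 0 := sub_ne_zero.2 hane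
  induction k with
  | zero => simp
  | succ k ih =>
    calc F (k + 1) ≤ a * F k + B * ρ ^ k := hF k
      _ ≤ a * (a ^ k * F 0 + B * ((a ^ k - ρ ^ k) / (a - ρ))) + B * ρ ^ k := by gcongr
      _ = _ := by
        field_simp
        ring

theorem geometric_recursion_le_max {F : ℕ → ℝ} {a ρ B : ℝ} (ha : 0 < a) (ha1 : a ≤ 1)
    (hρ : 0 < ρ) (hane : a ≠ ρ) (hB : 0 ≤ B) (hF0 : 0 ≤ F 0)
    (hF : ∀ k, F (k + 1) ≤ a * F k + B * ρ ^ k) (k : ℕ) :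
    F (k + 1) ≤ (F 0 + B * (1 / (1 - min a ρ / max a ρ))) * max a ρ ^ k := by
  have h := geometric_recursion_le ha.le hane hF (k + 1)
  have h1 : a ^ (k + 1) ≤ max a ρ ^ k :=
    (pow_le_pow_of_le_one ha.le ha1 k.le_succ).trans (pow_le_pow_left₀ ha.le (le_max_left _ _) k)
  have h2 : (a ^ (k + 1) - ρ ^ (k + 1)) / (a - ρ)
      ≤ 1 / (1 - min a ρ / max a ρ) * max a ρ ^ k := by
    have key : ∀ M q : ℝ, 0 < q → q < M →
        (M ^ (k + 1) - q ^ (k + 1)) / (M - q) ≤ 1 / (1 - q / M) * M ^ k := by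
      intro M q hq hqM
      have hM : 0 < M := hq.trans hqM
      have hd : 0 < M - q := sub_pos.2 hqM
      have he : 1 / (1 - q / M) * M ^ k = M ^ (k + 1) / (M - q) := by
        rw [one_sub_div hM.ne']
        field_simp
        ring
      rw [he]
      gcongr
      linarith [pow_pos hq (k + 1)]
    rcases lt_or_gt_of_ne hane with hlt | hlt
    · rw [min_eq_left hlt.le, max_eq_right hlt.le, ← neg_div_neg_eq, neg_sub, neg_sub]
      exact key ρ a ha hlt
    · rw [min_eq_right hlt.le, max_eq_left hlt.le]
      exact key a ρ hρ hlt
  calc F (k + 1) ≤ _ := h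
    _ ≤ max a ρ ^ k * F 0 + B * (1 / (1 - min a ρ / max a ρ) * max a ρ ^ k) := by gcongr
    _ = _ := by ring

theorem norm_le_div_of_mul_norm_sq_le_inner {E : Type*} [NormedAddCommGroup E]
    [InnerProductSpace ℝ E] {m : ℝ} (hm : 0 < m) {u v : E} (h : m * ‖v‖ ^ 2 ≤ ⟪u, v⟫) :
    ‖v‖ ≤ ‖u‖ / m := by
  rw [le_div_iff₀ hm]
  rcases (norm_nonneg v).eq_or_lt with h0 | h0
  · rw [← h0]
    simp
  · have h1 := h.trans (real_inner_le_norm u v)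
    nlinarith

theorem Matrix.det_ne_zero_of_mul_norm_sq_le_inner {n : ℕ} {m : ℝ} (hm : 0 < m)
    {A : Matrix (Fin n) (Fin n) ℝ}
    (h : ∀ v : EuclideanSpace ℝ (Fin n), m * ‖v‖ ^ 2 ≤ ⟪(Matrix.toEuclideanLin A) v, v⟫) :
    A.det ≠ 0 := by
  intro h0
  obtain ⟨v, hv, hAv⟩ := Matrix.exists_mulVec_eq_zero_iff.2 h0
  have hT : (Matrix.toEuclideanLin A) (WithLp.toLp 2 v) = 0 := by
    rw [Matrix.toLpLin_apply]
    simp [hAv]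
  have h1 := norm_le_div_of_mul_norm_sq_le_inner hm (h (WithLp.toLp 2 v))
  rw [hT, norm_zero, zero_div, norm_le_zero_iff] at h1
  exact hv (by simpa using h1)

/-- Linear convergence in expectation of the (VS-SQN) scheme with
geometrically increasing batch sizes. -/
theorem vs_sqn_linear_rate
    {n : ℕ} {Ω : Type*} {m0 : MeasurableSpace Ω} (P : Measure Ω) [IsProbabilityMeasure P]
    (ℱ : Filtration ℕ m0)
    (f : EuclideanSpace ℝ (Fin n) → ℝ) (gf : EuclideanSpace ℝ (Fin n) → EuclideanSpace ℝ (Fin n))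
    (τ L lam ulam ν₁ ν₂ ρ : ℝ)
    (hτ : 0 < τ) (hL : 0 < L) (hlam : 0 < lam) (hlamle : lam ≤ ulam)
    (hν₁ : 0 < ν₁) (hν₂ : 0 < ν₂) (hρ0 : 0 < ρ) (hρ1 : ρ < 1)
    (hsc : StrongConvexOn Set.univ τ f)
    (hgrad : ∀ z, HasGradientAt f (gf z) z)
    (hlip : ∀ z z', ‖gf z - gf z'‖ ≤ L * ‖z - z'‖)
    (xstar : EuclideanSpace ℝ (Fin n)) (hmin : ∀ z, f xstar ≤ f z)
    (x w : ℕ → Ω → EuclideanSpace ℝ (Fin n))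
    (H : ℕ → Ω → Matrix (Fin n) (Fin n) ℝ)
    (γ : ℕ → ℝ) (N : ℕ → ℕ) (N₀ : ℕ)
    (hx_meas : ∀ k, Measurable[ℱ k] (x k))
    (hf_int : ∀ k, Integrable (fun ω => f (x k ω)) P)
    (hH_meas : ∀ k, ∀ i j, Measurable[ℱ k] fun ω => H k ω i j)
    (hH_symm : ∀ k, ∀ᵐ ω ∂P, (H k ω).IsSymm)
    (hH_bnd : ∀ k, ∀ᵐ ω ∂P, ∀ v : EuclideanSpace ℝ (Fin n),
      lam * ‖v‖ ^ 2 ≤ ⟪(Matrix.toEuclideanLin (H k ω)) v, v⟫ ∧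
      ⟪(Matrix.toEuclideanLin (H k ω)) v, v⟫ ≤ ulam * ‖v‖ ^ 2)
    (hw_mean : ∀ k, P[w k | ℱ k] =ᵐ[P] 0)
    (hw_var : ∀ k, ∀ᵐ ω ∂P,
      (P[fun ω' => ‖w k ω'‖ ^ 2 | ℱ k]) ω ≤ (ν₁ ^ 2 * ‖x k ω‖ ^ 2 + ν₂ ^ 2) / (N k))
    (hupdate : ∀ k ω, x (k + 1) ω
      = x k ω - γ k • (Matrix.toEuclideanLin (H k ω)) (gf (x k ω) + w k ω))
    (hγ : ∀ k, γ k = 1 / (L * ulam))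
    (hN : ∀ k, N k = ⌈(N₀ : ℝ) / ρ ^ k⌉₊)
    (hN0 : 2 * ν₁ ^ 2 * ulam / (τ ^ 2 * lam) < (N₀ : ℝ))
    (a : ℝ) (ha : a = 1 - τ * lam / (L * ulam) + 2 * ν₁ ^ 2 / (L * τ * N₀))
    (ha0 : 0 < a) (ha1 : a < 1) (hane : a ≠ ρ)
    (C : ℝ)
    (hC : C = (∫ ω, (f (x 0 ω) - f xstar) ∂P)
        + (2 * ν₁ ^ 2 * ‖xstar‖ ^ 2 + ν₂ ^ 2) / (2 * N₀ * L)
          * (1 / (1 - min a ρ / max a ρ))) :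
    ∀ K, ∫ ω, (f (x (K + 1) ω) - f xstar) ∂P ≤ C * (max a ρ) ^ K := by
  have hulam : 0 < ulam := hlam.trans_le hlamle
  have hN₀ : (0 : ℝ) < N₀ := lt_of_le_of_lt (by positivity) hN0
  have hxm : ∀ k, Measurable (x k) := fun k => (hx_meas k).mono (ℱ.le k) le_rfl
  have hgrowth := hsc.norm_sub_sq_le (hgrad xstar) hmin
  have hgap : ∀ k, Integrable (fun ω => f (x k ω) - f xstar) P := fun k =>
    (hf_int k).sub (integrable_const _)
  have hxL2 : ∀ k, MemLp (fun ω => x k ω - xstar) 2 P := by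
    intro k
    have hm : AEStronglyMeasurable (fun ω => x k ω - xstar) P :=
      ((hxm k).sub_const _).aestronglyMeasurable
    refine (memLp_two_iff_integrable_sq_norm hm).2 (((hgap k).const_mul (2 / τ)).mono'
      (hm.norm.pow 2) (ae_of_all _ fun ω => ?_))
    have h := hgrowth (x k ω)
    rw [Real.norm_of_nonneg (by positivity), div_mul_eq_mul_div, le_div_iff₀ hτ]
    linarith
  have hxL2' : ∀ k, MemLp (x k) 2 P := fun k =>
    ((hxL2 k).add (memLp_const xstar)).ae_eq (ae_of_all _ fun ω => by simp)
  have hgfc : Continuous gf := by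
    refine (LipschitzWith.of_dist_le_mul (K := L.toNNReal) fun z z' => ?_).continuous
    rw [Real.coe_toNNReal _ hL.le, dist_eq_norm, dist_eq_norm]
    exact hlip z z'
  have hgL2 : ∀ k, MemLp (fun ω => gf (x k ω)) 2 P := by
    intro k
    have h : MemLp (fun ω => gf (x k ω) - gf xstar) 2 P :=
      (hxL2 k).of_le_mul
        ((hgfc.measurable.comp (hxm k)).sub_const _).aestronglyMeasurable
        (ae_of_all _ fun ω => hlip _ _)
    exact (h.add (memLp_const (gf xstar))).ae_eq (ae_of_all _ fun ω => by simp)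
  have hLu : L * ulam ≠ 0 := by positivity
  have hstep : ∀ k ω, (Matrix.toEuclideanLin (H k ω)) (gf (x k ω) + w k ω)
      = (L * ulam) • (x k ω - x (k + 1) ω) := by
    intro k ω
    rw [hupdate k ω, hγ k, sub_sub_cancel, smul_smul, mul_one_div_cancel hLu, one_smul]
  have hwL2 : ∀ k, MemLp (w k) 2 P := by
    intro k
    have hm : AEStronglyMeasurable (fun ω => gf (x k ω) + w k ω) P := by
      refine aestronglyMeasurable_of_toEuclideanLin
        (fun i j => (hH_meas k i j).mono (ℱ.le k) le_rfl) ?_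
        (((hxm k).sub (hxm (k + 1))).const_smul (L * ulam)) (hstep k)
      filter_upwards [hH_bnd k] with ω hω
      exact Matrix.det_ne_zero_of_mul_norm_sq_le_inner hlam fun v => (hω v).1
    have h : MemLp (fun ω => gf (x k ω) + w k ω) 2 P := by
      refine ((hxL2' k).sub (hxL2' (k + 1))).of_le_mul (c := L * ulam / lam) hm ?_
      filter_upwards [hH_bnd k] with ω hω
      have hb := norm_le_div_of_mul_norm_sq_le_inner hlam (hω (gf (x k ω) + w k ω)).1
      rw [hstep k ω, norm_smul, Real.norm_of_nonneg (by positivity)] at hb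
      rwa [div_mul_eq_mul_div]
    exact (h.sub (hgL2 k)).ae_eq (ae_of_all _ fun ω => by simp)
  have hwint : ∀ k, Integrable (fun ω => ‖w k ω‖ ^ 2) P := fun k => (hwL2 k).integrable_norm_pow'
  set F : ℕ → ℝ := fun k => ∫ ω, (f (x k ω) - f xstar) ∂P with hF
  have hF0 : ∀ k, 0 ≤ F k := fun k => integral_nonneg fun ω => sub_nonneg.2 (hmin _)
  have hx2 : ∀ k, ∫ ω, ‖x k ω‖ ^ 2 ∂P ≤ 4 / τ * F k + 2 * ‖xstar‖ ^ 2 := by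
    intro k
    calc ∫ ω, ‖x k ω‖ ^ 2 ∂P
        ≤ ∫ ω, (4 / τ * (f (x k ω) - f xstar) + 2 * ‖xstar‖ ^ 2) ∂P := by
          refine integral_mono (hxL2' k).integrable_norm_pow'
            (((hgap k).const_mul _).add (integrable_const _)) fun ω => ?_
          have h1 : ‖x k ω‖ ≤ ‖x k ω - xstar‖ + ‖xstar‖ := by
            simpa using norm_add_le (x k ω - xstar) xstar
          have h2 : ‖x k ω - xstar‖ ^ 2 ≤ 2 / τ * (f (x k ω) - f xstar) := by
            have h := hgrowth (x k ω)
            rw [div_mul_eq_mul_div, le_div_iff₀ hτ]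
            linarith
          have h3 : 4 / τ * (f (x k ω) - f xstar) = 2 * (2 / τ * (f (x k ω) - f xstar)) := by
            ring
          show ‖x k ω‖ ^ 2 ≤ 4 / τ * (f (x k ω) - f xstar) + 2 * ‖xstar‖ ^ 2
          rw [h3]
          nlinarith [norm_nonneg (x k ω), sq_nonneg (‖x k ω - xstar‖ - ‖xstar‖)]
      _ = 4 / τ * F k + 2 * ‖xstar‖ ^ 2 := by
          rw [integral_add ((hgap k).const_mul _) (integrable_const _), integral_const_mul]
          simp [hF]
  have hNk : ∀ k, 1 / (N k : ℝ) ≤ ρ ^ k / N₀ := by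
    intro k
    rw [hN k, ← one_div_div (N₀ : ℝ) (ρ ^ k)]
    exact one_div_le_one_div_of_le (by positivity) (Nat.le_ceil _)
  have hw2 : ∀ k, ∫ ω, ‖w k ω‖ ^ 2 ∂P
      ≤ (ν₁ ^ 2 * (4 / τ * F k + 2 * ‖xstar‖ ^ 2) + ν₂ ^ 2) * (ρ ^ k / N₀) := by
    intro k
    have hxi : Integrable (fun ω => ν₁ ^ 2 * ‖x k ω‖ ^ 2) P :=
      (hxL2' k).integrable_norm_pow'.const_mul _
    calc ∫ ω, ‖w k ω‖ ^ 2 ∂P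
        = ∫ ω, (P[fun ω' => ‖w k ω'‖ ^ 2 | ℱ k]) ω ∂P := (integral_condExp (ℱ.le k)).symm
      _ ≤ ∫ ω, (ν₁ ^ 2 * ‖x k ω‖ ^ 2 + ν₂ ^ 2) / (N k) ∂P :=
          integral_mono_ae integrable_condExp
            ((hxi.add (integrable_const _)).div_const _) (hw_var k)
      _ = (ν₁ ^ 2 * ∫ ω, ‖x k ω‖ ^ 2 ∂P + ν₂ ^ 2) * (1 / (N k)) := by
          rw [integral_div, integral_add hxi (integrable_const _), integral_const_mul]
          simp [div_eq_mul_inv]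
      _ ≤ _ := by
          have := hF0 k
          refine mul_le_mul ?_ (hNk k) (by positivity) (by positivity)
          gcongr
          exact hx2 k
  have hdescent : ∀ k, F (k + 1) ≤ (1 - τ * lam / (L * ulam)) * F k
      + 1 / (2 * L) * ∫ ω, ‖w k ω‖ ^ 2 ∂P := by
    intro k
    calc F (k + 1) ≤ ∫ ω, ((1 - τ * lam / (L * ulam)) * (f (x k ω) - f xstar)
          + 1 / (2 * L) * ‖w k ω‖ ^ 2) ∂P := by
          refine integral_mono_ae (hgap (k + 1))
            (((hgap k).const_mul _).add ((hwint k).const_mul _)) ?_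
          filter_upwards [hH_symm k, hH_bnd k] with ω hs hb
          have hT : (Matrix.toEuclideanLin (H k ω)).IsSymmetric :=
            Matrix.isSymmetric_toEuclideanLin_iff.2 (by
              rw [Matrix.IsHermitian, Matrix.conjTranspose_eq_transpose_of_trivial]
              exact hs)
          have h1 := sub_preconditioned_step_le hL hlam.le hulam hgrad hlip hT hb
            (x k ω) (w k ω)
          rw [← hγ k, ← hupdate k ω] at h1
          have h2 := hsc.two_mul_sub_le_norm_sq hτ (hgrad (x k ω)) xstar
          have h3 : lam / (2 * L * ulam) * (2 * τ * (f (x k ω) - f xstar))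
              ≤ lam / (2 * L * ulam) * ‖gf (x k ω)‖ ^ 2 := by gcongr
          have h4 : lam / (2 * L * ulam) * (2 * τ * (f (x k ω) - f xstar))
              = τ * lam / (L * ulam) * (f (x k ω) - f xstar) := by
            field_simp
          show f (x (k + 1) ω) - f xstar ≤ (1 - τ * lam / (L * ulam)) * (f (x k ω) - f xstar)
            + 1 / (2 * L) * ‖w k ω‖ ^ 2
          linarith
      _ = _ := by
          rw [integral_add ((hgap k).const_mul _) ((hwint k).const_mul _),
            integral_const_mul, integral_const_mul]
  have hrec : ∀ k, F (k + 1) ≤ a * F k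
      + (2 * ν₁ ^ 2 * ‖xstar‖ ^ 2 + ν₂ ^ 2) / (2 * N₀ * L) * ρ ^ k := by
    intro k
    have hk := hF0 k
    have hρk : ρ ^ k ≤ 1 := pow_le_one₀ hρ0.le hρ1.le
    calc F (k + 1) ≤ _ := hdescent k
      _ ≤ (1 - τ * lam / (L * ulam)) * F k + 1 / (2 * L) *
          ((ν₁ ^ 2 * (4 / τ * F k + 2 * ‖xstar‖ ^ 2) + ν₂ ^ 2) * (ρ ^ k / N₀)) := by
          gcongr
          exact hw2 k
      _ = (1 - τ * lam / (L * ulam)) * F k + 2 * ν₁ ^ 2 / (L * τ * N₀) * F k * ρ ^ k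
          + (2 * ν₁ ^ 2 * ‖xstar‖ ^ 2 + ν₂ ^ 2) / (2 * N₀ * L) * ρ ^ k := by
          field_simp
          ring
      _ ≤ (1 - τ * lam / (L * ulam)) * F k + 2 * ν₁ ^ 2 / (L * τ * N₀) * F k * 1
          + (2 * ν₁ ^ 2 * ‖xstar‖ ^ 2 + ν₂ ^ 2) / (2 * N₀ * L) * ρ ^ k := by gcongr
      _ = _ := by
          rw [ha]
          ring
  rw [hC]
  exact geometric_recursion_le_max ha0 ha1.le hρ0 hane (by positivity) (hF0 0) hrec
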